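/- arXiv:1912.07102 — 2 statements merged into one kernel-verified Lean document; each statement's English description precedes it below -/
import Mathlib

section
/- Let p be an odd prime and q = p^n. Then K(SL_2(F_q)) = ℚ(√(q*), ζ_{q−1} + ζ_{q−1}^{−1}, ζ_{q+1} + ζ_{q+1}^{−1}), where q* := (−1)^{(q−1)/2} q. -/
open CategoryTheory

/-- `zeta N` is the root of unity `e^{2 π i / N}`. -/
noncomputable def zeta (N : ℕ) : ℂ := Complex.exp (2 * Real.pi * Complex.I / N)

/-- `charField G` is the field `K(G)` generated over `ℚ` by all values of
irreducible complex characters of `G`. -/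
noncomputable def charField (G : Type) [Group G] : IntermediateField ℚ ℂ :=
  IntermediateField.adjoin ℚ
    {x : ℂ | ∃ V : FDRep ℂ G, Simple V ∧ ∃ g : G, V.character g = x}

/-- `charFieldAt G d` is the field `K_d(G)` generated over `ℚ` by the values of
irreducible complex characters of `G` at elements of order exactly `d`. -/
noncomputable def charFieldAt (G : Type) [Group G] (d : ℕ) : IntermediateField ℚ ℂ :=
  IntermediateField.adjoin ℚ
    {x : ℂ | ∃ V : FDRep ℂ G, Simple V ∧ ∃ g : G, orderOf g = d ∧ V.character g = x}


theorem exists_trace_pow_eq_sum {V : Type*} [AddCommGroup V] [Module ℂ V]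
    [FiniteDimensional ℂ V] (f : Module.End ℂ V) {N : ℕ} (hN : 0 < N) (hf : f ^ N = 1) :
    ∃ d : ℂ → ℕ, ∀ a : ℕ, LinearMap.trace ℂ V (f ^ a) =
      ∑ z ∈ Polynomial.nthRootsFinset N (1 : ℂ), (d z : ℂ) * z ^ a := by
  classical
  have haev : Polynomial.aeval f (Polynomial.X ^ N - 1 : Polynomial ℂ) = 0 := by simp [hf]
  have hss : f.IsSemisimple := by
    refine Module.End.isSemisimple_of_squarefree_aeval_eq_zero ?_ haev
    have : (Polynomial.X ^ N - 1 : Polynomial ℂ).Separable :=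
      Polynomial.X_pow_sub_one_separable_iff.mpr (by exact_mod_cast hN.ne')
    exact this.squarefree
  have htop : ⨆ z, f.eigenspace z = ⊤ := by
    rw [← Module.End.iSup_maxGenEigenspace_eq_top f]
    simp_rw [hss.isFinitelySemisimple.maxGenEigenspace_eq_eigenspace]
  have hroot : ∀ z, f.eigenspace z ≠ ⊥ → z ∈ Polynomial.nthRootsFinset N (1 : ℂ) := by
    intro z hz
    obtain ⟨v, hv⟩ := Module.End.HasEigenvalue.exists_hasEigenvector (f := f) (μ := z) hz
    rw [Polynomial.mem_nthRootsFinset hN]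
    have h1 := hv.pow_apply N
    rw [hf, Module.End.one_apply] at h1
    have : (z ^ N - 1) • v = 0 := by rw [sub_smul, ← h1, one_smul, sub_self]
    exact sub_eq_zero.mp ((smul_eq_zero.mp this).resolve_right hv.2)
  let ι := {z // z ∈ Polynomial.nthRootsFinset N (1 : ℂ)}
  have hint : DirectSum.IsInternal (fun z : ι => f.eigenspace (z : ℂ)) := by
    rw [DirectSum.isInternal_submodule_iff_iSupIndep_and_iSup_eq_top]
    refine ⟨f.eigenspaces_iSupIndep.comp Subtype.val_injective, ?_⟩
    rw [eq_top_iff, ← htop]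
    refine iSup_le fun z => ?_
    by_cases hz : f.eigenspace z = ⊥
    · simp [hz]
    · exact le_iSup (fun z : ι => f.eigenspace (z : ℂ)) ⟨z, hroot z hz⟩
  refine ⟨fun z => Module.finrank ℂ (f.eigenspace z), fun a => ?_⟩
  have hact : ∀ (z : ℂ) (v : V), v ∈ f.eigenspace z → (f ^ a) v = z ^ a • v := by
    intro z v hv
    rw [Module.End.mem_eigenspace_iff] at hv
    induction a with
    | zero => simp
    | succ k ih => rw [pow_succ, Module.End.mul_apply, hv, map_smul, ih, smul_smul, pow_succ']
  have hmaps : ∀ z : ι, Set.MapsTo (f ^ a) (f.eigenspace (z : ℂ)) (f.eigenspace (z : ℂ)) := by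
    intro z v hv
    rw [hact z v hv]
    exact Submodule.smul_mem _ _ hv
  rw [LinearMap.trace_eq_sum_trace_restrict hint hmaps,
    ← Finset.sum_coe_sort (Polynomial.nthRootsFinset N (1 : ℂ))]
  refine Finset.sum_congr rfl fun z _ => ?_
  have : (f ^ a).restrict (hmaps z) = ((z : ℂ) ^ a) • LinearMap.id := by
    exact LinearMap.ext fun v => Subtype.ext (hact z v v.2)
  rw [this, map_smul, LinearMap.trace_id, smul_eq_mul, mul_comm]


open scoped MonoidAlgebra in
theorem FDRep.simple_of_ofModule' {G : Type} [Group G] [Finite G] (S : Type) [AddCommGroup S]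
    [Module ℂ S] [Module ℂ[G] S] [IsScalarTower ℂ ℂ[G] S] [FiniteDimensional ℂ S]
    [IsSimpleModule ℂ[G] S] :
    Simple (FDRep.of (Representation.ofModule' S : Representation ℂ G S)) := by
  set ρ : Representation ℂ G S := Representation.ofModule' S with hρ
  rw [FDRep.simple_iff_end_is_rank_one]
  refine finrank_eq_one (𝟙 _) ?_ ?_
  · intro h
    have := IsSimpleModule.nontrivial ℂ[G] S
    obtain ⟨x, hx⟩ := exists_ne (0 : S)
    have := congrArg (fun φ : (FDRep.of ρ ⟶ FDRep.of ρ) => φ.hom.hom x) h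
    exact hx this
  · intro φ
    let l : S →ₗ[ℂ] S := φ.hom.hom.hom
    have hl : ∀ (g : G) (v : S), l (MonoidAlgebra.single g (1 : ℂ) • v)
        = MonoidAlgebra.single g (1 : ℂ) • l v := by
      intro g v
      have h := φ.comm g
      have := congrArg (fun ψ => ψ.hom.hom v) h
      exact this
    obtain ⟨c, hc⟩ := (IsSimpleModule.algebraMap_end_bijective_of_isAlgClosed (A := ℂ[G]) (V := S) ℂ).2
      (MonoidAlgebra.equivariantOfLinearOfComm l hl)
    refine ⟨c, ?_⟩
    ext v
    exact congrArg (fun ψ : Module.End ℂ[G] S => ψ v) hc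

open scoped MonoidAlgebra in
theorem isConj_of_character_eq {G : Type} [Group G] [Finite G] {g h : G}
    (H : ∀ V : FDRep ℂ G, Simple V → V.character g = V.character h) : IsConj g h := by
  classical
  have := Fintype.ofFinite G
  let cl : G → ℂ[G] := fun y => ∑ x : G, MonoidAlgebra.single (x * y * x⁻¹) (1 : ℂ)
  have hcl : ∀ y z, MonoidAlgebra.single z (1 : ℂ) * cl y = cl y * MonoidAlgebra.single z 1 := by
    intro y z
    simp only [cl, Finset.mul_sum, Finset.sum_mul, MonoidAlgebra.single_mul_single, mul_one]
    refine Fintype.sum_equiv (Equiv.mulLeft z) _ _ fun x => ?_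
    simp [mul_assoc]
  let f := cl g - cl h
  have hf : ∀ a : ℂ[G], a * f = f * a := by
    intro a
    induction a using MonoidAlgebra.induction_on with
    | of z => simp only [f, mul_sub, sub_mul, MonoidAlgebra.of_apply, hcl]
    | add a b ha hb => rw [add_mul, mul_add, ha, hb]
    | smul r a ha => rw [smul_mul_assoc, mul_smul_comm, ha]
  have key : ∀ S : Submodule ℂ[G] ℂ[G], IsSimpleModule ℂ[G] S → ∀ s ∈ S, f * s = 0 := by
    intro S hS s hs
    let ρ : Representation ℂ G S := Representation.ofModule' S
    have hsimple : Simple (FDRep.of ρ) := FDRep.simple_of_ofModule' S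
    let m : Module.End ℂ[G] S :=
      { toFun := fun v => f • v
        map_add' := smul_add f
        map_smul' := fun a v => by simp only [RingHom.id_apply, smul_smul, hf] }
    obtain ⟨c, hc⟩ :=
      (IsSimpleModule.algebraMap_end_bijective_of_isAlgClosed (A := ℂ[G]) (V := S) ℂ).2 m
    have hc' : ∀ v : S, f • v = c • v := fun v =>
      (congrArg (fun ψ : Module.End ℂ[G] S => ψ v) hc).symm
    have htr : LinearMap.trace ℂ S (Algebra.lsmul ℂ ℂ S f) = 0 := by
      have hx : ∀ y : G, LinearMap.trace ℂ S (Algebra.lsmul ℂ ℂ S (cl y)) =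
          Fintype.card G * (FDRep.of ρ).character y := by
        intro y
        simp only [cl, map_sum]
        rw [← nsmul_eq_mul, ← Finset.card_univ, ← Finset.sum_const]
        refine Finset.sum_congr rfl fun x _ => ?_
        rw [← FDRep.char_conj _ y x]
        rfl
      simp only [f, map_sub, hx, H _ hsimple, sub_self]
    have hsc : Algebra.lsmul ℂ ℂ S f = c • LinearMap.id := LinearMap.ext hc'
    rw [hsc, map_smul, LinearMap.trace_id, smul_eq_mul] at htr
    have hnt := IsSimpleModule.nontrivial ℂ[G] S
    have hc0 : c = 0 := (mul_eq_zero.mp htr).resolve_right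
      (by exact_mod_cast (Module.finrank_pos (R := ℂ) (M := S)).ne')
    have := hc' ⟨s, hs⟩
    rw [hc0, zero_smul] at this
    exact congrArg Subtype.val this
  have hf0 : f = 0 := by
    let A : Submodule ℂ[G] ℂ[G] :=
      { carrier := {v | f * v = 0}
        add_mem' := fun {a b} ha hb => by
          simp only [Set.mem_ofPred_eq] at *; rw [mul_add, ha, hb, add_zero]
        zero_mem' := mul_zero f
        smul_mem' := fun a v hv => by
          simp only [Set.mem_ofPred_eq, smul_eq_mul] at *
          rw [← mul_assoc, ← hf, mul_assoc, hv, mul_zero] }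
    have hA : (⊤ : Submodule ℂ[G] ℂ[G]) ≤ A := by
      rw [← IsSemisimpleModule.sSup_simples_eq_top ℂ[G] ℂ[G]]
      exact sSup_le fun S hS s hs => key S hS s hs
    have := hA (x := 1) trivial
    simpa using (show f * 1 = 0 from this)
  have hcoef : (cl g).coeff g = (cl h).coeff g := by rw [sub_eq_zero.mp hf0]
  by_contra hnc
  have h1 : (cl h).coeff g = 0 := by
    simp only [cl, MonoidAlgebra.coeff_sum, MonoidAlgebra.coeff_single,
      Finsupp.finsetSum_apply, Finsupp.single_apply]
    refine Finset.sum_eq_zero fun x _ => if_neg fun hx => hnc ?_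
    exact (isConj_iff.mpr ⟨x, hx⟩).symm
  have h2 : (cl g).coeff g ≠ 0 := by
    simp only [cl, MonoidAlgebra.coeff_sum, MonoidAlgebra.coeff_single,
      Finsupp.finsetSum_apply, Finsupp.single_apply, Finset.sum_boole]
    exact_mod_cast (Finset.card_pos.mpr ⟨1, by simp⟩).ne'
  exact h2 (hcoef.trans h1)

section

open Matrix

/-- The binary quadratic form `v ↦ det [v, g v]` attached to a `2 × 2` matrix `g`. -/
def cyclicForm {F : Type*} [Field F] (g : Matrix (Fin 2) (Fin 2) F) (x y : F) : F :=
  g 1 0 * x ^ 2 + (g 1 1 - g 0 0) * x * y - g 0 1 * y ^ 2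

theorem isConj_of_cyclicForm_eq {F : Type*} [Field F] {g h : Matrix.SpecialLinearGroup (Fin 2) F}
    (htr : (g : Matrix (Fin 2) (Fin 2) F).trace = (h : Matrix (Fin 2) (Fin 2) F).trace)
    {x y z w : F} (hne : cyclicForm (g : Matrix (Fin 2) (Fin 2) F) x y ≠ 0)
    (hQ : cyclicForm (g : Matrix (Fin 2) (Fin 2) F) x y =
      cyclicForm (h : Matrix (Fin 2) (Fin 2) F) z w) : IsConj g h := by
  let cyc : Matrix (Fin 2) (Fin 2) F → F → F → Matrix (Fin 2) (Fin 2) F := fun g x y =>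
    !![x, g 0 0 * x + g 0 1 * y; y, g 1 0 * x + g 1 1 * y]
  have hdet : ∀ g x y, (cyc g x y).det = cyclicForm g x y := by
    intro g x y
    simp only [cyc, det_fin_two_of, cyclicForm]
    ring
  have hcomp : ∀ (g : Matrix.SpecialLinearGroup (Fin 2) F) (x y : F),
      (g : Matrix (Fin 2) (Fin 2) F) * cyc g x y =
        cyc g x y * !![0, -1; 1, (g : Matrix (Fin 2) (Fin 2) F).trace] := by
    intro g x y
    have hg := g.det_coe
    rw [det_fin_two] at hg
    ext i j
    fin_cases i <;> fin_cases j <;>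
      simp [cyc, mul_apply, Fin.sum_univ_two, trace_fin_two]
    · linear_combination (-x) * hg
    · linear_combination (-y) * hg
  set δ := cyclicForm (g : Matrix (Fin 2) (Fin 2) F) x y with hδ
  set P := cyc g x y
  set P' := cyc h z w
  set C := !![0, -1; 1, (g : Matrix (Fin 2) (Fin 2) F).trace]
  have hP : P.det = δ := hdet _ _ _
  have hP' : P'.det = δ := (hdet _ _ _).trans hQ.symm
  have hgP : (g : Matrix (Fin 2) (Fin 2) F) * P = P * C := hcomp g x y
  have hhP : (h : Matrix (Fin 2) (Fin 2) F) * P' = P' * C := by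
    have := hcomp h z w
    rwa [← htr] at this
  have hunit : IsUnit P.det := by rw [hP]; exact hne.isUnit
  have hgP' : P⁻¹ * (g : Matrix (Fin 2) (Fin 2) F) = C * P⁻¹ := by
    calc P⁻¹ * (g : Matrix (Fin 2) (Fin 2) F) = P⁻¹ * (g * P) * P⁻¹ := by
          rw [mul_assoc, mul_assoc, mul_nonsing_inv _ hunit, mul_one]
      _ = C * P⁻¹ := by
          rw [hgP, ← mul_assoc, nonsing_inv_mul _ hunit, one_mul]
  have hX : (P' * P⁻¹).det = 1 := by
    rw [det_mul, det_nonsing_inv, hP, hP', Ring.inverse_eq_inv', mul_inv_cancel₀ hne]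
  rw [isConj_iff]
  let X : Matrix.SpecialLinearGroup (Fin 2) F := ⟨P' * P⁻¹, hX⟩
  refine ⟨X, ?_⟩
  rw [mul_inv_eq_iff_eq_mul]
  apply Subtype.ext
  change P' * P⁻¹ * (g : Matrix (Fin 2) (Fin 2) F) = h * (P' * P⁻¹)
  rw [mul_assoc, hgP', ← mul_assoc, ← mul_assoc, hhP]

theorem Matrix.SpecialLinearGroup.sq_eq {R : Type*} [CommRing R]
    (g : Matrix.SpecialLinearGroup (Fin 2) R) :
    (g : Matrix (Fin 2) (Fin 2) R) ^ 2 = (g : Matrix (Fin 2) (Fin 2) R).trace • g - 1 := by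
  have hg := g.det_coe
  rw [det_fin_two] at hg
  ext i j
  fin_cases i <;> fin_cases j <;> simp [pow_two, mul_apply, Fin.sum_univ_two, trace_fin_two] <;>
    first | linear_combination (-1 : R) * hg | linear_combination hg | ring

theorem exists_cyclicForm_eq_one {F : Type*} [Field F] [Fintype F] (hF : Odd (Fintype.card F))
    (h2 : (2 : F) ≠ 0)
    {g : Matrix.SpecialLinearGroup (Fin 2) F} (ht : (g : Matrix (Fin 2) (Fin 2) F).trace ^ 2 ≠ 4) :
    ∃ x y, cyclicForm (g : Matrix (Fin 2) (Fin 2) F) x y = 1 := by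
  have hg := g.det_coe
  rw [det_fin_two] at hg
  rw [trace_fin_two] at ht
  unfold cyclicForm
  generalize (g : Matrix (Fin 2) (Fin 2) F) 0 0 = a at *
  generalize (g : Matrix (Fin 2) (Fin 2) F) 0 1 = b at *
  generalize (g : Matrix (Fin 2) (Fin 2) F) 1 0 = c at *
  generalize (g : Matrix (Fin 2) (Fin 2) F) 1 1 = d at *
  set D := (d - a) ^ 2 + 4 * b * c with hD
  have hD0 : D ≠ 0 := by
    intro h
    apply ht
    linear_combination h + 4 * hg
  by_cases hc : c = 0
  · have hda : d - a ≠ 0 := by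
      intro h
      apply hD0
      rw [hD, h, hc]
      ring
    refine ⟨(1 + b) / (d - a), 1, ?_⟩
    subst hc
    field_simp
    ring
  · obtain ⟨X, Y, hXY⟩ := FiniteField.exists_root_sum_quadratic (R := F)
      (f := Polynomial.C 1 * Polynomial.X ^ 2 + Polynomial.C 0 * Polynomial.X + Polynomial.C (-(4 * c)))
      (g := Polynomial.C (-D) * Polynomial.X ^ 2 + Polynomial.C 0 * Polynomial.X + Polynomial.C 0)
      (Polynomial.degree_quadratic one_ne_zero) (Polynomial.degree_quadratic (neg_ne_zero.mpr hD0))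
      (Nat.odd_iff.mp hF)
    simp at hXY
    refine ⟨(X - (d - a) * Y) / (2 * c), Y, ?_⟩
    field_simp
    linear_combination hXY + Y ^ 2 * hD

theorem pow_sub_or_pow_add_eq_one {F : Type*} [Field F] [Fintype F]
    (h2 : ringChar F ≠ 2)
    {g : Matrix.SpecialLinearGroup (Fin 2) F} (ht : (g : Matrix (Fin 2) (Fin 2) F).trace ^ 2 ≠ 4) :
    g ^ (Fintype.card F - 1) = 1 ∨ g ^ (Fintype.card F + 1) = 1 := by
  set A : Matrix (Fin 2) (Fin 2) F := (g : Matrix (Fin 2) (Fin 2) F) with hA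
  set t := A.trace
  set q := Fintype.card F with hq
  obtain ⟨n, hp, hn⟩ := FiniteField.card F (ringChar F)
  have : Fact (ringChar F).Prime := ⟨hp⟩
  have h20 : (2 : F) ≠ 0 := Ring.two_ne_zero h2
  have hsq : A ^ 2 = t • A - 1 := g.sq_eq
  have hqodd : Odd q := by
    rw [hq]; exact Nat.odd_iff.mpr (FiniteField.odd_card_of_char_ne_two h2)
  obtain ⟨k, hk⟩ := hqodd
  have hk' : q / 2 = k := by omega
  set D := t ^ 2 - 4
  have hD : D ≠ 0 := sub_ne_zero.mpr ht
  set B : Matrix (Fin 2) (Fin 2) F := (2 : F) • A - t • 1 with hB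
  have hBsq : B ^ 2 = D • 1 := by
    rw [hB, pow_two, sub_mul, mul_sub, mul_sub]
    simp only [smul_mul_smul_comm, mul_one, one_mul]
    rw [← pow_two A, hsq]
    module
  have hBq : B ^ q = (2 : F) • A ^ q - t • 1 := by
    have hcomm : Commute ((2 : F) • A) (t • (1 : Matrix (Fin 2) (Fin 2) F)) :=
      (Commute.one_right _).smul_right _
    rw [hB, hq, hn, sub_pow_char_pow_of_commute _ _ hcomm, ← hn, smul_pow, smul_pow, one_pow,
      FiniteField.pow_card, FiniteField.pow_card]
  have hBq' : B ^ q = D ^ (q / 2) • B := by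
    rw [hk', hk, pow_add, pow_mul, hBsq, pow_one, smul_pow, one_pow, smul_mul_assoc, one_mul]
  have hAinv : (t • (1 : Matrix (Fin 2) (Fin 2) F) - A) * A = 1 := by
    rw [sub_mul, smul_mul_assoc, one_mul, ← pow_two, hsq, sub_sub_cancel]
  rcases FiniteField.pow_dichotomy h2 hD with h | h
  · left
    have h1 : (2 : F) • A ^ q = (2 : F) • A := by
      have := hBq.symm.trans hBq'
      rw [← hq] at h
      rw [h, one_smul, hB] at this
      exact sub_left_injective this
    have h1' := smul_right_injective _ h20 h1
    have : g ^ q = g := Subtype.ext (by simpa using h1')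
    have hq1 : q = (q - 1) + 1 := by omega
    rw [hq1, pow_succ] at this
    exact mul_eq_right.mp this
  · right
    have h1 : (2 : F) • A ^ q = (2 : F) • (t • 1 - A) := by
      have := hBq.symm.trans hBq'
      rw [← hq] at h
      rw [h, hB] at this
      rw [sub_eq_iff_eq_add.mp this]
      module
    have h1' := smul_right_injective _ h20 h1
    apply Subtype.ext
    change A ^ (q + 1) = 1
    rw [pow_succ, h1', hAinv]


/-- `a` is congruent to `1` or to `-1` modulo `m`. -/
def IsPlusMinusOneMod (a m : ℕ) : Prop := a ≡ 1 [MOD m] ∨ m ∣ a + 1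

theorem IsPlusMinusOneMod.pow_eq {G : Type*} [Group G] {g : G} {a m : ℕ}
    (h : IsPlusMinusOneMod a m) (hg : g ^ m = 1) : g ^ a = g ∨ g ^ a = g⁻¹ := by
  rcases h with h | h
  · left
    have := pow_eq_pow_iff_modEq.mpr (h.of_dvd (orderOf_dvd_of_pow_eq_one hg))
    rwa [pow_one] at this
  · right
    rw [eq_inv_iff_mul_eq_one, ← pow_succ]
    exact orderOf_dvd_iff_pow_eq_one.mp ((orderOf_dvd_of_pow_eq_one hg).trans h)

theorem eq_inv_iff_mul_eq_one_of_ne {K : Type*} [Field K] {x y : K} (hy : y ≠ 0) :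
    x = y⁻¹ ↔ x * y = 1 :=
  ⟨fun h => by rw [h, inv_mul_cancel₀ hy], eq_inv_of_mul_eq_one_left⟩

theorem add_inv_eq_add_inv_iff {K : Type*} [Field K] {x y : K} (hx : x ≠ 0) (hy : y ≠ 0) :
    x + x⁻¹ = y + y⁻¹ ↔ x = y ∨ x = y⁻¹ := by
  constructor
  · intro h
    have : (x - y) * (x * y - 1) = 0 := by
      field_simp at h
      linear_combination h
    rcases mul_eq_zero.mp this with h | h
    · exact Or.inl (sub_eq_zero.mp h)
    · exact Or.inr (eq_inv_of_mul_eq_one_left (sub_eq_zero.mp h))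
  · rintro (rfl | rfl)
    · rfl
    · rw [inv_inv, add_comm]

theorem IsPrimitiveRoot.pow_add_inv_eq_iff {K : Type*} [Field K] {y : K} {m : ℕ} [NeZero m]
    (hy : IsPrimitiveRoot y m) (a : ℕ) :
    y ^ a + (y ^ a)⁻¹ = y + y⁻¹ ↔ IsPlusMinusOneMod a m := by
  have hy0 : y ≠ 0 := hy.ne_zero (NeZero.ne m)
  rw [add_inv_eq_add_inv_iff (pow_ne_zero _ hy0) hy0, IsPlusMinusOneMod]
  refine or_congr ?_ ?_
  · lift y to Kˣ using hy0.isUnit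
    rw [hy.eq_orderOf, orderOf_units, ← pow_eq_pow_iff_modEq, pow_one]
    norm_cast
  · rw [eq_inv_iff_mul_eq_one_of_ne hy0, ← pow_succ, hy.pow_eq_one_iff_dvd]

theorem trace_pow_of_trace_eq {F K : Type*} [Field F] [Field K] [Algebra F K]
    (g : Matrix.SpecialLinearGroup (Fin 2) F) {y : K} (hy : y ≠ 0)
    (h : algebraMap F K (g : Matrix (Fin 2) (Fin 2) F).trace = y + y⁻¹) (a : ℕ) :
    algebraMap F K ((g ^ a : Matrix.SpecialLinearGroup (Fin 2) F) : Matrix (Fin 2) (Fin 2) F).trace =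
      y ^ a + (y ^ a)⁻¹ := by
  induction a using Nat.twoStepInduction with
  | zero =>
    simp only [pow_zero, Matrix.SpecialLinearGroup.coe_one, trace_one, Fintype.card_fin, inv_one,
      one_add_one_eq_two]
    exact map_ofNat _ 2
  | one => simpa using h
  | more k h0 h1 =>
    rw [Matrix.SpecialLinearGroup.coe_pow] at *
    rw [pow_add, g.sq_eq, mul_sub, mul_one, mul_smul_comm, ← pow_succ, trace_sub, trace_smul,
      map_sub, smul_eq_mul, map_mul, h, h0, h1]
    field_simp
    ring

theorem isPlusMinusOneMod_of_isConj_pow {F K : Type*} [Field F] [Field K] [Algebra F K]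
    {a m : ℕ} [NeZero m] (H : ∀ g : Matrix.SpecialLinearGroup (Fin 2) F, IsConj (g ^ a) g)
    {y : K} (hy : IsPrimitiveRoot y m) (ht : y + y⁻¹ ∈ Set.range (algebraMap F K)) :
    IsPlusMinusOneMod a m := by
  obtain ⟨t, ht⟩ := ht
  let g : Matrix.SpecialLinearGroup (Fin 2) F := ⟨!![0, -1; 1, t], by simp⟩
  have hg : (g : Matrix (Fin 2) (Fin 2) F).trace = t := by simp [g, trace_fin_two]
  rw [← hy.pow_add_inv_eq_iff, ← trace_pow_of_trace_eq g (hy.ne_zero (NeZero.ne m))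
    (by rw [hg, ht]), ← ht]
  obtain ⟨c, hc⟩ := isConj_iff.mp (H g).symm
  rw [← hg, ← hc, Matrix.SpecialLinearGroup.coe_mul, trace_mul_comm, ← Matrix.SpecialLinearGroup.coe_mul,
    inv_mul_cancel_left]

theorem isSquare_of_isConj_pow {F : Type*} [Field F] {a : ℕ}
    (H : ∀ g : Matrix.SpecialLinearGroup (Fin 2) F, IsConj (g ^ a) g) : IsSquare (a : F) := by
  let u : Matrix.SpecialLinearGroup (Fin 2) F := ⟨!![1, 1; 0, 1], by simp⟩
  have hu : ∀ k : ℕ, ((u ^ k : Matrix.SpecialLinearGroup (Fin 2) F) : Matrix (Fin 2) (Fin 2) F) =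
      !![1, (k : F); 0, 1] := by
    intro k
    induction k with
    | zero => ext i j; fin_cases i <;> fin_cases j <;> simp
    | succ k ih =>
      rw [pow_succ, Matrix.SpecialLinearGroup.coe_mul, ih]
      ext i j
      fin_cases i <;> fin_cases j <;> simp [u, mul_apply, Fin.sum_univ_two, add_comm]
  by_cases ha : (a : F) = 0
  · rw [ha]; exact IsSquare.zero
  obtain ⟨c, hc⟩ := isConj_iff.mp (H u).symm
  rw [mul_inv_eq_iff_eq_mul] at hc
  have hc' : (c : Matrix (Fin 2) (Fin 2) F) * !![1, 1; 0, 1] =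
      !![1, (a : F); 0, 1] * (c : Matrix (Fin 2) (Fin 2) F) := by
    rw [← hu a, ← Matrix.SpecialLinearGroup.coe_mul, ← hc]
    rfl
  have h00 := congrFun (congrFun hc' 0) 0
  have h01 := congrFun (congrFun hc' 0) 1
  simp [mul_apply, Fin.sum_univ_two] at h00 h01
  have hdet := c.det_coe
  rw [det_fin_two] at hdet
  have h10 : (c : Matrix (Fin 2) (Fin 2) F) 1 0 = 0 := by
    rcases h00 with h | h
    · exact absurd h ha
    · exact h
  rw [h10, mul_zero, sub_zero] at hdet
  have hx : (c : Matrix (Fin 2) (Fin 2) F) 0 0 = a * (c : Matrix (Fin 2) (Fin 2) F) 1 1 := by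
    linear_combination h01
  refine ⟨(c : Matrix (Fin 2) (Fin 2) F) 0 0, ?_⟩
  linear_combination (-(a : F)) * hdet + (c : Matrix (Fin 2) (Fin 2) F) 0 0 * (-1) * hx

theorem exists_isPrimitiveRoot_add_inv_mem {F : Type*} [Field F] [Fintype F] {m : ℕ}
    (hm : (m : F) ≠ 0) (h : m = Fintype.card F - 1 ∨ m = Fintype.card F + 1) :
    ∃ y : AlgebraicClosure F, IsPrimitiveRoot y m ∧
      y + y⁻¹ ∈ Set.range (algebraMap F (AlgebraicClosure F)) := by
  have : NeZero (m : AlgebraicClosure F) :=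
    ⟨by
      rw [← map_natCast (algebraMap F (AlgebraicClosure F))]
      exact (map_ne_zero _).mpr hm⟩
  have hm0 : m ≠ 0 := by rintro rfl; simp at hm
  obtain ⟨y, hy⟩ := HasEnoughRootsOfUnity.exists_primitiveRoot (AlgebraicClosure F) m
  refine ⟨y, hy, ?_⟩
  have hy0 : y ≠ 0 := hy.ne_zero hm0
  have hq := Fintype.card_pos (α := F)
  obtain ⟨n, hp, hn⟩ := FiniteField.card F (ringChar F)
  have : Fact (ringChar F).Prime := ⟨hp⟩
  have : CharP (AlgebraicClosure F) (ringChar F) :=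
    charP_of_injective_algebraMap (algebraMap F (AlgebraicClosure F)).injective _
  have hpow : (y + y⁻¹) ^ Fintype.card F = y + y⁻¹ := by
    have hsum : (y + y⁻¹) ^ Fintype.card F = y ^ Fintype.card F + (y ^ Fintype.card F)⁻¹ := by
      rw [hn, add_pow_char_pow, inv_pow]
    rw [hsum, add_inv_eq_add_inv_iff (pow_ne_zero _ hy0) hy0]
    rcases h with h | h
    · left
      have := hy.pow_eq_one
      rw [h] at this
      rw [← Nat.sub_add_cancel hq, pow_succ, this, one_mul]
    · right
      rw [eq_inv_iff_mul_eq_one_of_ne hy0, ← pow_succ, ← h, hy.pow_eq_one]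
  have hX := FiniteField.X_pow_card_sub_X_ne_zero F (Fintype.one_lt_card (α := F))
  have hroots := FiniteField.roots_X_pow_card_sub_X F
  have hsplit : ((Polynomial.X ^ Fintype.card F - Polynomial.X : Polynomial F)).Splits := by
    rw [Polynomial.splits_iff_card_roots, hroots,
      FiniteField.X_pow_card_sub_X_natDegree_eq F (Fintype.one_lt_card (α := F))]
    simp
  refine hsplit.mem_range_of_isRoot hX ?_
  simp [hpow]

theorem isConj_pow_of_trace_sq_eq_four {F : Type*} [Field F] (h2 : (2 : F) ≠ 0) {a : ℕ}
    (hodd : Odd a) (hsq : IsSquare (a : F)) (ha0 : (a : F) ≠ 0)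
    {g : Matrix.SpecialLinearGroup (Fin 2) F} (ht : (g : Matrix (Fin 2) (Fin 2) F).trace ^ 2 = 4) :
    IsConj (g ^ a) g := by
  obtain ⟨b, hb⟩ := hsq
  obtain ⟨e, he⟩ : ∃ e, (g : Matrix (Fin 2) (Fin 2) F).trace = 2 * e :=
    ⟨(g : Matrix (Fin 2) (Fin 2) F).trace / 2, by field_simp⟩
  have he2 : e ^ 2 = 1 := by
    have h4 : (2 : F) ^ 2 ≠ 0 := pow_ne_zero _ h2
    apply mul_left_cancel₀ h4
    rw [he] at ht
    linear_combination ht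
  have hpow : ((g ^ a : Matrix.SpecialLinearGroup (Fin 2) F) : Matrix (Fin 2) (Fin 2) F) =
      (e * (1 - a)) • 1 + (a : F) • (g : Matrix (Fin 2) (Fin 2) F) := by
    rw [Matrix.SpecialLinearGroup.coe_pow]
    have hgsq := g.sq_eq
    rw [he] at hgsq
    obtain ⟨k, rfl⟩ := hodd
    clear hb ha0
    induction k with
    | zero => simp
    | succ k ih =>
      have : 2 * (k + 1) + 1 = (2 * k + 1) + 2 := by ring
      have hg3 : (g : Matrix (Fin 2) (Fin 2) F) * ((2 * e) • (g : Matrix (Fin 2) (Fin 2) F) - 1) =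
          (2 * e) • ((2 * e) • (g : Matrix (Fin 2) (Fin 2) F) - 1) - g := by
        rw [mul_sub, mul_smul_comm, ← pow_two, hgsq, mul_one]
      rw [this, pow_add, ih, add_mul, smul_mul_assoc, one_mul, smul_mul_assoc, hgsq, hg3]
      push_cast
      match_scalars
      · linear_combination 4 * (k + 1) * he2
      · ring
  by_cases hQ : ∃ x y, cyclicForm (g : Matrix (Fin 2) (Fin 2) F) x y ≠ 0
  · obtain ⟨x, y, hxy⟩ := hQ
    have hb0 : b ≠ 0 := by rintro rfl; simp at hb; exact ha0 hb
    have key : cyclicForm (g : Matrix (Fin 2) (Fin 2) F) (b * x) (b * y) = b ^ 2 *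
        cyclicForm (g : Matrix (Fin 2) (Fin 2) F) x y := by
      unfold cyclicForm; ring
    refine (isConj_of_cyclicForm_eq (x := b * x) (y := b * y) (z := x) (w := y) ?_ ?_ ?_).symm
    · rw [hpow, trace_add, trace_smul, trace_smul, he]
      simp
      ring
    · rw [key]; exact mul_ne_zero (pow_ne_zero _ hb0) hxy
    · rw [key, hpow]
      simp [cyclicForm, hb]
      ring
  · push Not at hQ
    have h1 := hQ 1 0
    have h3 := hQ 0 1
    have h5 := hQ 1 1
    simp [cyclicForm] at h1 h3 h5
    rw [h1, h3] at h5
    have h6 : (g : Matrix (Fin 2) (Fin 2) F) 1 1 = (g : Matrix (Fin 2) (Fin 2) F) 0 0 := by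
      linear_combination h5
    have h7 : (g : Matrix (Fin 2) (Fin 2) F) 0 0 = e := by
      rw [trace_fin_two, h6] at he
      apply mul_left_cancel₀ h2
      linear_combination he
    have : g ^ a = g := by
      apply Subtype.ext
      change ((g ^ a : Matrix.SpecialLinearGroup (Fin 2) F) : Matrix (Fin 2) (Fin 2) F) = g
      rw [hpow]
      ext i j
      fin_cases i <;> fin_cases j <;> simp [h1, h3, h6, h7] <;> ring
    rw [this]

theorem isConj_pow_of_isPlusMinusOneMod {F : Type*} [Field F] [Fintype F] (h2 : ringChar F ≠ 2)
    {a : ℕ} (hodd : Odd a) (hsq : IsSquare (a : F)) (ha0 : (a : F) ≠ 0)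
    (h1 : IsPlusMinusOneMod a (Fintype.card F - 1))
    (h3 : IsPlusMinusOneMod a (Fintype.card F + 1)) (g : Matrix.SpecialLinearGroup (Fin 2) F) :
    IsConj (g ^ a) g := by
  have h20 : (2 : F) ≠ 0 := Ring.two_ne_zero h2
  have hcard : Odd (Fintype.card F) := Nat.odd_iff.mpr (FiniteField.odd_card_of_char_ne_two h2)
  by_cases ht : (g : Matrix (Fin 2) (Fin 2) F).trace ^ 2 = 4
  · exact isConj_pow_of_trace_sq_eq_four h20 hodd hsq ha0 ht
  have hga : g ^ a = g ∨ g ^ a = g⁻¹ := by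
    rcases pow_sub_or_pow_add_eq_one h2 ht with h | h
    · exact h1.pow_eq h
    · exact h3.pow_eq h
  rcases hga with h | h
  · rw [h]
  rw [h]
  have htr : ((g⁻¹ : Matrix.SpecialLinearGroup (Fin 2) F) : Matrix (Fin 2) (Fin 2) F).trace =
      (g : Matrix (Fin 2) (Fin 2) F).trace := by
    rw [Matrix.SpecialLinearGroup.coe_inv, adjugate_fin_two, trace_fin_two, trace_fin_two]
    simp [add_comm]
  obtain ⟨x, y, hxy⟩ := exists_cyclicForm_eq_one hcard h20 (g := g⁻¹) (by rwa [htr])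
  obtain ⟨z, w, hzw⟩ := exists_cyclicForm_eq_one hcard h20 ht
  exact isConj_of_cyclicForm_eq htr (by rw [hxy]; exact one_ne_zero) (hxy.trans hzw.symm)

end

theorem IntermediateField.adjoin_le_adjoin_of_forall_algEquiv {K L : Type*} [Field K] [Field L]
    [Algebra K L] {M : IntermediateField K L} [FiniteDimensional K M] [IsGalois K M]
    {A B : Set L} (hB : B ⊆ M)
    (h : ∀ σ : M ≃ₐ[K] M, (∀ x : M, (x : L) ∈ A → σ x = x) → ∀ x : M, (x : L) ∈ B → σ x = x) :
    adjoin K B ≤ adjoin K A := by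
  rw [adjoin_le_iff]
  intro b hb
  have hmem : (⟨b, hB hb⟩ : M) ∈ adjoin K ((↑) ⁻¹' A : Set M) := by
    rw [← IsGalois.fixedField_fixingSubgroup (adjoin K ((↑) ⁻¹' A : Set M)), mem_fixedField_iff]
    intro σ hσ
    rw [mem_fixingSubgroup_iff] at hσ
    exact h σ (fun x hx => hσ x (subset_adjoin _ _ hx)) _ hb
  have hmap : b ∈ (adjoin K ((↑) ⁻¹' A : Set M)).map M.val := ⟨_, hmem, rfl⟩
  rw [adjoin_map] at hmap
  refine adjoin.mono _ _ _ ?_ hmap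
  rintro _ ⟨x, hx, rfl⟩
  exact hx

theorem IntermediateField.coe_algEquiv_eq_sum {K L : Type*} [Field K] [Field L] [Algebra K L]
    {M : IntermediateField K L} {N a : ℕ} (hM : ∀ z : L, z ^ N = 1 → z ∈ M) {σ : M ≃ₐ[K] M}
    (hσ : ∀ z : M, z ^ N = 1 → σ z = z ^ a) {ι : Type*} {s : Finset ι} {c : ι → ℤ} {z : ι → L}
    (hz : ∀ i ∈ s, z i ^ N = 1) {x : M} (hx : (x : L) = ∑ i ∈ s, (c i : L) * z i) :
    (σ x : L) = ∑ i ∈ s, (c i : L) * z i ^ a := by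
  have hx' : x = ∑ i ∈ s.attach, (c i : M) * ⟨z i, hM _ (hz i i.2)⟩ := by
    apply Subtype.ext
    rw [hx, ← Finset.sum_attach, ← coe_val, map_sum]
    rfl
  rw [hx', map_sum, ← coe_val, map_sum, ← Finset.sum_attach s]
  refine Finset.sum_congr rfl fun i _ => ?_
  rw [map_mul, map_intCast, hσ _ (Subtype.ext (hz i i.2))]
  simp

theorem FDRep.exists_character_pow_eq_sum {G : Type*} [Group G] (V : FDRep ℂ G) (g : G) {N : ℕ}
    (hN : 0 < N) (hg : g ^ N = 1) :
    ∃ d : ℂ → ℕ, ∀ a : ℕ, V.character (g ^ a) =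
      ∑ z ∈ Polynomial.nthRootsFinset N (1 : ℂ), (d z : ℂ) * z ^ a := by
  obtain ⟨d, hd⟩ := exists_trace_pow_eq_sum (V.ρ g) hN (by rw [← map_pow, hg, map_one])
  exact ⟨d, fun a => by rw [← hd a, ← map_pow]; rfl⟩

theorem exists_gaussSum_pow_eq {F : Type} [Field F] [Fintype F] [DecidableEq F] (h2 : ringChar F ≠ 2)
    {s : ℂ} (hs : s ^ 2 = (-1) ^ ((Fintype.card F - 1) / 2) * (Fintype.card F : ℂ)) :
    ∃ (c : F → ℤ) (z : F → ℂ), (∀ x, z x ^ ringChar F = 1) ∧ s = ∑ x, (c x : ℂ) * z x ∧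
      ∀ a : ℕ, (a : F) ≠ 0 →
        ∑ x, (c x : ℂ) * z x ^ a = (quadraticChar F (a : F) : ℂ) * s := by
  obtain ⟨ψ, hψ⟩ := AddChar.exists_apply_ne_zero.mpr (one_ne_zero (α := F))
  have hψ1 : ψ.IsPrimitive := AddChar.IsPrimitive.of_ne_one (by rintro rfl; simp at hψ)
  let χ : MulChar F ℂ := (quadraticChar F).ringHomComp (Int.castRingHom ℂ)
  have hχ : ∀ x, χ x = (quadraticChar F x : ℂ) := fun _ => rfl
  have hχ1 : χ ≠ 1 := by
    obtain ⟨x, hx⟩ := quadraticChar_exists_neg_one' h2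
    intro h
    have h1 := hχ x
    rw [h, MulChar.one_apply_coe, hx] at h1
    norm_num at h1
  have hodd := FiniteField.odd_card_of_char_ne_two h2
  have hG : gaussSum χ ψ ^ 2 = s ^ 2 := by
    rw [gaussSum_sq hχ1 ((quadraticChar_isQuadratic F).comp _) hψ1, hs, hχ,
      quadraticChar_neg_one h2, ZMod.χ₄_eq_neg_one_pow hodd,
      show (Fintype.card F - 1) / 2 = Fintype.card F / 2 by omega]
    push_cast
    rfl
  obtain ⟨ε, hε⟩ : ∃ ε : ℤ, s = ε * gaussSum χ ψ := by
    rcases sq_eq_sq_iff_eq_or_eq_neg.mp hG with h | h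
    · exact ⟨1, by simp [h]⟩
    · exact ⟨-1, by simp [h]⟩
  refine ⟨fun x => ε * quadraticChar F x, ψ, fun x => ?_, ?_, fun a ha => ?_⟩
  · rw [← AddChar.map_nsmul_eq_pow, nsmul_eq_mul, CharP.cast_eq_zero, zero_mul,
      AddChar.map_zero_eq_one]
  · rw [hε, gaussSum, Finset.mul_sum]
    refine Finset.sum_congr rfl fun x _ => ?_
    rw [hχ]
    push_cast
    ring
  · have h1 := gaussSum_mulShift χ ψ (Units.mk0 _ ha)
    rw [Units.val_mk0, hχ] at h1
    have h3 : ((quadraticChar F (a : F) : ℤ) : ℂ) ^ 2 = 1 := by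
      exact_mod_cast quadraticChar_sq_one ha
    rw [hε, ← h1]
    have h4 : ∑ x, ((ε * quadraticChar F x : ℤ) : ℂ) * ψ x ^ a =
        ε * gaussSum χ (ψ.mulShift (a : F)) := by
      rw [gaussSum, Finset.mul_sum]
      refine Finset.sum_congr rfl fun x _ => ?_
      rw [hχ, AddChar.mulShift_apply, ← AddChar.map_nsmul_eq_pow, nsmul_eq_mul]
      push_cast
      ring
    rw [h4]
    linear_combination (-(ε : ℂ) * gaussSum χ (ψ.mulShift (a : F))) * h3

theorem IntermediateField.exists_coprime_forall_algEquiv_eq_pow {K L : Type*} [Field K] [Field L]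
    [Algebra K L] {M : IntermediateField K L} {ζ : L} {N : ℕ} [NeZero N] (hζ : IsPrimitiveRoot ζ N)
    (hM : ζ ∈ M) (σ : M ≃ₐ[K] M) :
    ∃ a : ℕ, a.Coprime N ∧ ∀ z : M, z ^ N = 1 → σ z = z ^ a := by
  have hζ' : IsPrimitiveRoot (⟨ζ, hM⟩ : M) N :=
    hζ.of_map_of_injective (f := M.val) M.val.injective
  refine ⟨(hζ'.autToPow K σ : ZMod N).val, ZMod.val_coe_unit_coprime _, fun z hz => ?_⟩
  obtain ⟨i, -, rfl⟩ := hζ'.eq_pow_of_pow_eq_one hz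
  rw [map_pow, ← hζ'.autToPow_spec K σ, pow_right_comm]

theorem forall_isConj_pow_iff {F : Type*} [Field F] [Fintype F] (h2 : ringChar F ≠ 2) {a : ℕ}
    (hodd : Odd a) (ha0 : (a : F) ≠ 0) :
    (∀ g : Matrix.SpecialLinearGroup (Fin 2) F, IsConj (g ^ a) g) ↔
      IsSquare (a : F) ∧ IsPlusMinusOneMod a (Fintype.card F - 1) ∧
        IsPlusMinusOneMod a (Fintype.card F + 1) := by
  refine ⟨fun H => ⟨isSquare_of_isConj_pow H, ?_, ?_⟩,
    fun h => isConj_pow_of_isPlusMinusOneMod h2 hodd h.1 ha0 h.2.1 h.2.2⟩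
  · have : NeZero (Fintype.card F - 1) := ⟨by have := Fintype.one_lt_card (α := F); omega⟩
    obtain ⟨y, hy, ht⟩ := exists_isPrimitiveRoot_add_inv_mem (F := F)
      (by simp [Nat.cast_sub Fintype.card_pos]) (Or.inl rfl)
    exact isPlusMinusOneMod_of_isConj_pow H hy ht
  · obtain ⟨y, hy, ht⟩ := exists_isPrimitiveRoot_add_inv_mem (F := F) (by simp) (Or.inr rfl)
    exact isPlusMinusOneMod_of_isConj_pow H hy ht

theorem forall_algEquiv_character_iff {G : Type} [Group G] [Finite G] {K : Type*}
    [Field K] [Algebra K ℂ] {M : IntermediateField K ℂ}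
    {N a : ℕ} (hN : 0 < N) (hG : ∀ g : G, g ^ N = 1) (hM : ∀ z : ℂ, z ^ N = 1 → z ∈ M)
    {σ : M ≃ₐ[K] M} (hσ : ∀ z : M, z ^ N = 1 → σ z = z ^ a) :
    (∀ x : M, (∃ V : FDRep ℂ G, Simple V ∧ ∃ g : G, V.character g = (x : ℂ)) → σ x = x) ↔
      ∀ g : G, IsConj (g ^ a) g := by
  have key : ∀ (V : FDRep ℂ G) (g : G), V.character g ∈ M ∧
      ∀ x : M, V.character g = (x : ℂ) → (σ x : ℂ) = V.character (g ^ a) := by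
    intro V g
    obtain ⟨d, hd⟩ := V.exists_character_pow_eq_sum g hN (hG g)
    have hz : ∀ z ∈ Polynomial.nthRootsFinset N (1 : ℂ), z ^ N = 1 := fun z hz =>
      (Polynomial.mem_nthRootsFinset hN _).mp hz
    have h1 := hd 1
    simp only [pow_one] at h1
    refine ⟨?_, fun x hx => ?_⟩
    · rw [h1]
      exact sum_mem fun z hz' => mul_mem (natCast_mem _ _) (hM z (hz z hz'))
    · rw [hd a, IntermediateField.coe_algEquiv_eq_sum hM hσ (c := fun z => (d z : ℤ)) hz
        (hx.symm.trans (by simpa using h1))]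
      simp
  constructor
  · intro h g
    refine isConj_of_character_eq fun V hV => ?_
    obtain ⟨hmem, hV'⟩ := key V g
    rw [← hV' ⟨_, hmem⟩ rfl, h ⟨_, hmem⟩ ⟨V, hV, g, rfl⟩]
  · rintro h x ⟨V, -, g, hg⟩
    apply Subtype.ext
    obtain ⟨c, hc⟩ := isConj_iff.mp (h g)
    rw [(key V g).2 x hg, ← hg, ← V.char_conj (g ^ a) c, hc]

theorem isPrimitiveRoot_zeta {m : ℕ} (hm : m ≠ 0) : IsPrimitiveRoot (zeta m) m :=
  Complex.isPrimitiveRoot_exp m hm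

theorem algEquiv_zeta_add_inv_iff {K : Type*} [Field K] [Algebra K ℂ] {M : IntermediateField K ℂ}
    {N a m : ℕ} (hm : m ≠ 0)
    (hmN : m ∣ N) {σ : M ≃ₐ[K] M} (hσ : ∀ z : M, z ^ N = 1 → σ z = z ^ a)
    (hM : ∀ z : ℂ, z ^ N = 1 → z ∈ M) :
    (∀ x : M, (x : ℂ) = zeta m + (zeta m)⁻¹ → σ x = x) ↔ IsPlusMinusOneMod a m := by
  have : NeZero m := ⟨hm⟩
  have hz := isPrimitiveRoot_zeta hm
  have hzN : zeta m ^ N = 1 := (hz.pow_eq_one_iff_dvd N).mpr hmN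
  let z : M := ⟨zeta m, hM _ hzN⟩
  have h1 : ((z + z⁻¹ : M) : ℂ) = zeta m + (zeta m)⁻¹ := rfl
  have h2 : σ (z + z⁻¹) = z + z⁻¹ ↔ IsPlusMinusOneMod a m := by
    rw [← hz.pow_add_inv_eq_iff, map_add, map_inv₀, hσ z (Subtype.ext hzN), Subtype.ext_iff]
    rfl
  rw [← h2]
  refine ⟨fun h => h _ h1, fun h x hx => ?_⟩
  rw [Subtype.ext (hx.trans h1.symm), h]

theorem adjoin_character_specialLinearGroup_eq (K : Type*) [Field K] [Algebra K ℂ] {F : Type}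
    [Field F] [Fintype F] (h2 : ringChar F ≠ 2) {s : ℂ}
    (hs : s ^ 2 = (-1) ^ ((Fintype.card F - 1) / 2) * (Fintype.card F : ℂ)) :
    IntermediateField.adjoin K {x : ℂ | ∃ V : FDRep ℂ (Matrix.SpecialLinearGroup (Fin 2) F),
        Simple V ∧ ∃ g, V.character g = x} =
      IntermediateField.adjoin K {s, zeta (Fintype.card F - 1) + (zeta (Fintype.card F - 1))⁻¹,
        zeta (Fintype.card F + 1) + (zeta (Fintype.card F + 1))⁻¹} := by
  classical
  obtain ⟨p, hchar⟩ := CharP.exists F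
  have hring : ringChar F = p := ringChar.eq F p
  have hp : p.Prime := (CharP.char_is_prime_or_zero F p).resolve_right
    (CharP.char_ne_zero_of_finite F p)
  have hq1 : Fintype.card F - 1 ≠ 0 := by
    have := Fintype.one_lt_card (α := F)
    omega
  set m₁ := Fintype.card F - 1 with hm₁
  set m₂ := Fintype.card F + 1 with hm₂
  have hm₂0 : m₂ ≠ 0 := Nat.succ_ne_zero _
  let N := Nat.card (Matrix.SpecialLinearGroup (Fin 2) F) * m₁ * m₂ * p * 2
  have hN : 0 < N := by
    have := Nat.card_pos (α := Matrix.SpecialLinearGroup (Fin 2) F)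
    have := hp.pos
    have := Nat.pos_of_ne_zero hq1
    positivity
  have : NeZero N := ⟨hN.ne'⟩
  have hζ := isPrimitiveRoot_zeta hN.ne'
  let M := IntermediateField.adjoin K {zeta N}
  have hcyc : IsCyclotomicExtension {N} K M :=
    (IntermediateField.isCyclotomicExtension_singleton_iff_eq_adjoin N K ℂ M hζ).mpr rfl
  have : FiniteDimensional K M := IsCyclotomicExtension.finiteDimensional {N} K M
  have : IsGalois K M := IsCyclotomicExtension.isGalois {N} K M
  have hζM : zeta N ∈ M := IntermediateField.mem_adjoin_simple_self K _
  have hM : ∀ z : ℂ, z ^ N = 1 → z ∈ M := by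
    intro z hz
    obtain ⟨i, -, rfl⟩ := hζ.eq_pow_of_pow_eq_one hz
    exact pow_mem hζM i
  have hm₁N : m₁ ∣ N := ⟨Nat.card (Matrix.SpecialLinearGroup (Fin 2) F) * m₂ * p * 2, by
    simp only [N]; ring⟩
  have hm₂N : m₂ ∣ N := ⟨Nat.card (Matrix.SpecialLinearGroup (Fin 2) F) * m₁ * p * 2, by
    simp only [N]; ring⟩
  have hpN : p ∣ N := (dvd_mul_left _ _).mul_right _
  have hGN : ∀ g : Matrix.SpecialLinearGroup (Fin 2) F, g ^ N = 1 := by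
    intro g
    simp only [N, mul_assoc, pow_mul _ (Nat.card _), pow_card_eq_one', one_pow]
  obtain ⟨c, z, hz, hsum, hgauss⟩ := exists_gaussSum_pow_eq h2 hs
  have hzN : ∀ x ∈ Finset.univ, z x ^ N = 1 := by
    intro x _
    obtain ⟨k, hk⟩ := hpN
    rw [hk, pow_mul, ← hring, hz, one_pow]
  have hsM : s ∈ M := by
    rw [hsum]
    exact sum_mem fun x hx => mul_mem (intCast_mem _ _) (hM _ (hzN x hx))
  have hs0 : s ≠ 0 := by
    rintro rfl
    simp at hs
  have hiff : ∀ σ : M ≃ₐ[K] M,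
      (∀ x : M, (x : ℂ) ∈ {x : ℂ | ∃ V : FDRep ℂ (Matrix.SpecialLinearGroup (Fin 2) F),
        Simple V ∧ ∃ g, V.character g = x} → σ x = x) ↔
      ∀ x : M, (x : ℂ) ∈ ({s, zeta m₁ + (zeta m₁)⁻¹, zeta m₂ + (zeta m₂)⁻¹} : Set ℂ) →
        σ x = x := by
    intro σ
    obtain ⟨a, ha, hσ⟩ := IntermediateField.exists_coprime_forall_algEquiv_eq_pow hζ hζM σ
    have haodd : Odd a := Nat.coprime_two_right.mp (ha.coprime_dvd_right (dvd_mul_left _ _))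
    have ha0 : (a : F) ≠ 0 := by
      rw [Ne, CharP.cast_eq_zero_iff F p]
      exact hp.coprime_iff_not_dvd.mp (ha.coprime_dvd_right hpN).symm
    have hsquare : (∀ x : M, (x : ℂ) = s → σ x = x) ↔ IsSquare (a : F) := by
      have h : ∀ x : M, (x : ℂ) = s → (σ x = x ↔ IsSquare (a : F)) := by
        intro x hx
        rw [Subtype.ext_iff, IntermediateField.coe_algEquiv_eq_sum hM hσ hzN (hx.trans hsum),
          hgauss a ha0, hx, mul_eq_right₀ hs0, ← quadraticChar_one_iff_isSquare ha0]
        exact_mod_cast Iff.rfl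
      exact ⟨fun H => (h ⟨s, hsM⟩ rfl).mp (H _ rfl), fun H x hx => (h x hx).mpr H⟩
    refine (forall_algEquiv_character_iff hN hGN hM hσ).trans ?_
    rw [forall_isConj_pow_iff h2 haodd ha0, ← hsquare, ← hm₁, ← hm₂,
      ← algEquiv_zeta_add_inv_iff hq1 hm₁N hσ hM,
      ← algEquiv_zeta_add_inv_iff hm₂0 hm₂N hσ hM]
    simp only [Set.mem_insert_iff, Set.mem_singleton_iff, or_imp, forall_and]
  have hAM : {x : ℂ | ∃ V : FDRep ℂ (Matrix.SpecialLinearGroup (Fin 2) F),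
      Simple V ∧ ∃ g, V.character g = x} ⊆ M := by
    rintro _ ⟨V, -, g, rfl⟩
    obtain ⟨d, hd⟩ := V.exists_character_pow_eq_sum g hN (hGN g)
    rw [← pow_one g, hd 1]
    exact sum_mem fun z hz => mul_mem (natCast_mem _ _)
      (pow_mem (hM z ((Polynomial.mem_nthRootsFinset hN _).mp hz)) 1)
  have hBM : ({s, zeta m₁ + (zeta m₁)⁻¹, zeta m₂ + (zeta m₂)⁻¹} : Set ℂ) ⊆ M := by
    have hmem : ∀ m, m ≠ 0 → m ∣ N → zeta m + (zeta m)⁻¹ ∈ M := by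
      intro m hm hmN
      have := hM _ (((isPrimitiveRoot_zeta hm).pow_eq_one_iff_dvd N).mpr hmN)
      exact add_mem this (inv_mem this)
    rintro _ (rfl | rfl | rfl)
    · exact hsM
    · exact hmem _ hq1 hm₁N
    · exact hmem _ hm₂0 hm₂N
  exact le_antisymm
    (IntermediateField.adjoin_le_adjoin_of_forall_algEquiv hAM fun σ => (hiff σ).mpr)
    (IntermediateField.adjoin_le_adjoin_of_forall_algEquiv hBM fun σ => (hiff σ).mp)

/-- For `q = p^n` with `p` an odd prime,
`K(SL_2(F_q)) = ℚ(√(q*), ζ_{q−1} + ζ_{q−1}^{−1}, ζ_{q+1} + ζ_{q+1}^{−1})`, where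
`q* = (−1)^{(q−1)/2} q` and `s` is any complex square root of `q*`. -/
theorem statement7 (p n q : ℕ) (hp : p.Prime) (hodd : Odd p) (hn : 1 ≤ n)
    (hq : q = p ^ n) (F : Type) [Field F] [Fintype F] (hF : Fintype.card F = q)
    (s : ℂ) (hs : s ^ 2 = (-1) ^ ((q - 1) / 2) * (q : ℂ)) :
    charField (Matrix.SpecialLinearGroup (Fin 2) F) =
      IntermediateField.adjoin ℚ
        {s, zeta (q - 1) + (zeta (q - 1))⁻¹, zeta (q + 1) + (zeta (q + 1))⁻¹} := by
  have : Fact p.Prime := ⟨hp⟩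
  have hchar : CharP F p := charP_of_card_eq_prime_pow (hF.trans hq)
  subst hF
  refine adjoin_character_specialLinearGroup_eq ℚ ?_ hs
  rw [ringChar.eq F p]
  rintro rfl
  exact absurd hodd (by decide)
end

section
/- Let p be a prime, q = p^n, and let d be a positive divisor of q − 1 with d > 1. Then K_d(GL_2(F_q)) = K_{pd}(GL_2(F_q)) = ℚ(ζ_d). -/
open CategoryTheory

theorem trace_mem_adjoin_zeta {V : Type*} [AddCommGroup V] [Module ℂ V] [FiniteDimensional ℂ V]
    {d : ℕ} (hd : d ≠ 0) (T : Module.End ℂ V) (hT : T ^ (d + 1) = T) :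
    LinearMap.trace ℂ V T ∈ IntermediateField.adjoin ℚ {zeta d} := by
  rw [Module.End.trace_eq_sum_roots_charpoly_of_splits (IsAlgClosed.splits _)]
  refine multiset_sum_mem _ fun μ hμ => ?_
  rw [Polynomial.mem_roots T.charpoly_monic.ne_zero,
    ← Module.End.hasEigenvalue_iff_isRoot_charpoly] at hμ
  obtain ⟨v, hv⟩ := hμ.exists_hasEigenvector
  have hpow : μ ^ (d + 1) = μ := by
    have h := hv.pow_apply (d + 1)
    rw [hT, hv.apply_eq_smul] at h
    exact (smul_left_injective ℂ hv.2 h).symm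
  rcases eq_or_ne μ 0 with rfl | h0
  · exact zero_mem _
  · have : NeZero d := ⟨hd⟩
    have h1 : μ ^ d = 1 := by
      rw [pow_succ] at hpow
      exact mul_right_cancel₀ h0 (hpow.trans (one_mul μ).symm)
    obtain ⟨i, -, rfl⟩ := (Complex.isPrimitiveRoot_exp d hd).eq_pow_of_pow_eq_one h1
    exact pow_mem (IntermediateField.mem_adjoin_simple_self ℚ _) i

theorem simple_of_isIrreducible {G V : Type} [Group G] [Finite G] [AddCommGroup V] [Module ℂ V]
    [FiniteDimensional ℂ V] (ρ : Representation ℂ G V) [ρ.IsIrreducible] :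
    Simple (FDRep.of ρ) := by
  have := Fintype.ofFinite G
  have hG : (Nat.card G : ℂ) ≠ 0 := Nat.cast_ne_zero.mpr Nat.card_pos.ne'
  have := invertibleOfNonzero hG
  rw [FDRep.simple_iff_char_is_norm_one]
  have h := Representation.char_orthonormal ρ ρ
  rw [if_pos ⟨.refl ρ⟩, inv_mul_eq_one₀ hG] at h
  exact h.symm

theorem Subrepresentation.character_eq_add_of_isCompl {G V : Type*} [Group G] [AddCommGroup V]
    [Module ℂ V] [FiniteDimensional ℂ V] {ρ : Representation ℂ G V} {A B : Subrepresentation ρ}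
    (h : IsCompl A B) (g : G) :
    ρ.character g = A.toRepresentation.character g + B.toRepresentation.character g := by
  have hAB : IsCompl A.toSubmodule B.toSubmodule := by
    constructor
    · rw [disjoint_iff, ← Subrepresentation.toSubmodule_inf, h.inf_eq_bot]; rfl
    · rw [codisjoint_iff, ← Subrepresentation.toSubmodule_sup, h.sup_eq_top]; rfl
  let N : Bool → Submodule ℂ V := fun b => cond b A.toSubmodule B.toSubmodule
  have hN : DirectSum.IsInternal N :=
    (DirectSum.isInternal_submodule_iff_isCompl N (i := true) (j := false) (by simp)
      (by ext b; cases b <;> simp)).mpr hAB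
  have hf : ∀ b, Set.MapsTo (ρ g) (N b) (N b) := by
    rintro (_ | _)
    · exact B.apply_mem_toSubmodule g
    · exact A.apply_mem_toSubmodule g
  have := LinearMap.trace_eq_sum_trace_restrict hN hf
  rw [Fintype.sum_bool] at this
  exact this

theorem character_mem_charFieldAt {G V : Type} [Group G] [Finite G] [AddCommGroup V] [Module ℂ V]
    [FiniteDimensional ℂ V] (ρ : Representation ℂ G V) (g : G) :
    ρ.character g ∈ charFieldAt G (orderOf g) := by
  induction hn : Module.finrank ℂ V using Nat.strong_induction_on generalizing V with
  | _ n ih =>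
  by_cases hirr : ρ.IsIrreducible
  · exact IntermediateField.subset_adjoin _ _
      ⟨FDRep.of ρ, simple_of_isIrreducible ρ, g, rfl, rfl⟩
  rcases subsingleton_or_nontrivial V with hV | hV
  · have : ρ.character g = 0 := by
      rw [Representation.character, Subsingleton.elim (ρ g) 0, map_zero]
    exact this ▸ zero_mem _
  have hbt : (⊥ : Subrepresentation ρ) ≠ ⊤ := fun h =>
    bot_ne_top (congrArg Subrepresentation.toSubmodule h : (⊥ : Submodule ℂ V) = ⊤)
  obtain ⟨A, hA0, hA1⟩ : ∃ A : Subrepresentation ρ, A ≠ ⊥ ∧ A ≠ ⊤ := by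
    by_contra! hall
    have : Nontrivial (Subrepresentation ρ) := ⟨_, _, hbt⟩
    exact hirr ⟨fun A => or_iff_not_imp_left.mpr (hall A)⟩
  have : NeZero (Nat.card G : ℂ) := ⟨Nat.cast_ne_zero.mpr Nat.card_pos.ne'⟩
  obtain ⟨B, hAB⟩ := exists_isCompl A
  have hB1 : B ≠ ⊤ := fun h => hA0 (by rw [h] at hAB; exact eq_bot_of_isCompl_top hAB)
  have hlt : ∀ C : Subrepresentation ρ, C ≠ ⊤ → Module.finrank ℂ C.toSubmodule < n := by
    intro C hC
    rw [← hn]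
    exact Submodule.finrank_lt fun h => hC (Subrepresentation.toSubmodule_injective h)
  rw [Subrepresentation.character_eq_add_of_isCompl hAB]
  exact add_mem (ih _ (hlt A hA1) _ rfl) (ih _ (hlt B hB1) _ rfl)

section Jordan

variable {F : Type} [Field F]

/-- The invertible matrix with diagonal entries `a` and upper right entry `a * b`. -/
def jordan : Fˣ × Multiplicative F →* GL (Fin 2) F where
  toFun x := Matrix.GeneralLinearGroup.mkOfDetNeZero
    !![(x.1 : F), x.1 * x.2.toAdd; 0, x.1] (by simp [Matrix.det_fin_two])
  map_one' := by
    ext i j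
    fin_cases i <;> fin_cases j <;> simp [Matrix.GeneralLinearGroup.mkOfDetNeZero]
  map_mul' x y := by
    ext i j
    fin_cases i <;> fin_cases j <;>
      simp [Matrix.GeneralLinearGroup.mkOfDetNeZero, Matrix.mul_apply, Fin.sum_univ_two]
    ring

theorem coe_jordan (x : Fˣ × Multiplicative F) :
    (jordan x : Matrix (Fin 2) (Fin 2) F) = !![(x.1 : F), x.1 * x.2.toAdd; 0, x.1] := rfl

theorem jordan_injective : Function.Injective (jordan (F := F)) := by
  rintro ⟨a, b⟩ ⟨a', b'⟩ h
  have h := congrArg (fun g : GL (Fin 2) F => (g : Matrix (Fin 2) (Fin 2) F)) h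
  simp only [coe_jordan] at h
  have h0 := congrFun₂ h 0 0
  have h1 := congrFun₂ h 0 1
  simp only [Matrix.of_apply, Matrix.cons_val', Matrix.cons_val_zero, Matrix.cons_val_one,
    Matrix.cons_val_fin_one] at h0 h1
  obtain rfl := Units.ext h0
  exact Prod.ext rfl (Multiplicative.toAdd.injective (mul_left_cancel₀ a.ne_zero h1))

theorem orderOf_jordan_zero (a : Fˣ) :
    orderOf (jordan (a, Multiplicative.ofAdd 0)) = orderOf a := by
  rw [orderOf_injective _ jordan_injective, Prod.orderOf, ofAdd_zero, orderOf_one,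
    Nat.lcm_one_right]

theorem orderOf_jordan (p : ℕ) [Fact p.Prime] [CharP F p] (a : Fˣ) {b : F} (hb : b ≠ 0) :
    orderOf (jordan (a, Multiplicative.ofAdd b)) = (orderOf a).lcm p := by
  rw [orderOf_injective _ jordan_injective, Prod.orderOf, orderOf_ofAdd_eq_addOrderOf,
    addOrderOf_eq_prime (p := p) (by simp) hb]

theorem isConj_jordan (a : Fˣ) (b : F) {t : F} (ht : t ≠ 0) :
    IsConj (jordan (a, Multiplicative.ofAdd b)) (jordan (a, Multiplicative.ofAdd (t * b))) := by
  rw [isConj_iff]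
  refine ⟨Matrix.GeneralLinearGroup.mkOfDetNeZero !![t, 0; 0, 1] (by simpa using ht), ?_⟩
  rw [mul_inv_eq_iff_eq_mul]
  ext i j
  fin_cases i <;> fin_cases j <;>
    simp [coe_jordan, Matrix.GeneralLinearGroup.mkOfDetNeZero, Matrix.mul_apply,
      Fin.sum_univ_two] <;> ring

/-- A nonzero nilpotent `2 × 2` matrix is conjugate to the standard nilpotent Jordan block. -/
theorem exists_mul_eq_mul_of_isNilpotent {N : Matrix (Fin 2) (Fin 2) F} (hN : IsNilpotent N)
    (h0 : N ≠ 0) : ∃ P : GL (Fin 2) F,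
      N * (P : Matrix (Fin 2) (Fin 2) F) = (P : Matrix (Fin 2) (Fin 2) F) * !![0, 1; 0, 0] := by
  have htr : N.trace = 0 := (Matrix.isNilpotent_trace_of_isNilpotent hN).eq_zero
  have hdet : N.det = 0 := by
    obtain ⟨k, hk⟩ := hN
    have : N.det ^ k = 0 ∨ k = 0 := by
      rcases eq_or_ne k 0 with rfl | h
      · exact Or.inr rfl
      · left
        rw [← Matrix.det_pow, hk, Matrix.det_zero]
    rcases this with h | rfl
    · exact eq_zero_of_pow_eq_zero h
    · exact absurd hk (by simp)
  rw [Matrix.trace_fin_two] at htr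
  rw [Matrix.det_fin_two] at hdet
  by_cases h10 : N 1 0 = 0
  · have h00 : N 0 0 = 0 := by
      rw [h10] at hdet
      have : N 0 0 * N 0 0 = 0 := by linear_combination N 0 0 * htr - hdet
      exact mul_self_eq_zero.mp this
    have h11 : N 1 1 = 0 := by linear_combination htr - h00
    have h01 : N 0 1 ≠ 0 := fun h01 => h0 <| by
      ext i j
      fin_cases i <;> fin_cases j <;> simp [*]
    refine ⟨Matrix.GeneralLinearGroup.mkOfDetNeZero !![N 0 1, 0; 0, 1] (by simpa using h01), ?_⟩
    ext i j
    fin_cases i <;> fin_cases j <;>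
      simp [Matrix.GeneralLinearGroup.mkOfDetNeZero, Matrix.mul_apply, Fin.sum_univ_two, *]
  · refine ⟨Matrix.GeneralLinearGroup.mkOfDetNeZero !![N 0 0, 1; N 1 0, 0]
      (by simpa [Matrix.det_fin_two] using h10), ?_⟩
    ext i j
    fin_cases i <;> fin_cases j <;>
      simp [Matrix.GeneralLinearGroup.mkOfDetNeZero, Matrix.mul_apply, Fin.sum_univ_two]
    · linear_combination N 0 0 * htr - hdet
    · linear_combination N 1 0 * htr

theorem exists_isConj_jordan {N : Matrix (Fin 2) (Fin 2) F} (hN : IsNilpotent N) (h0 : N ≠ 0)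
    {g : GL (Fin 2) F} (hg : Commute (g : Matrix (Fin 2) (Fin 2) F) N) :
    ∃ (a : Fˣ) (b : F), IsConj g (jordan (a, Multiplicative.ofAdd b)) := by
  obtain ⟨P, hP⟩ := exists_mul_eq_mul_of_isNilpotent hN h0
  set E : Matrix (Fin 2) (Fin 2) F := !![0, 1; 0, 0] with hE
  set g' := P⁻¹ * g * P with hg'
  have hcomm : (g' : Matrix (Fin 2) (Fin 2) F) * E = E * g' := by
    have hP' : E =
        ((P⁻¹ : GL (Fin 2) F) : Matrix (Fin 2) (Fin 2) F) * N * (P : Matrix (Fin 2) (Fin 2) F) := by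
      rw [mul_assoc, hP, Units.inv_mul_cancel_left]
    rw [hg', hP']
    simp only [Units.val_mul, mul_assoc, Units.mul_inv_cancel_left]
    rw [← mul_assoc (g : Matrix (Fin 2) (Fin 2) F) N, hg.eq, mul_assoc]
  have e00 := congrFun₂ hcomm 0 0
  have e01 := congrFun₂ hcomm 0 1
  simp only [Fin.isValue, Matrix.mul_apply, Fin.sum_univ_two, hE, Matrix.of_apply,
    Matrix.cons_val', Matrix.cons_val_zero, Matrix.cons_val_fin_one, mul_zero,
    Matrix.cons_val_one, add_zero, zero_mul, one_mul, zero_add, mul_one] at e00 e01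
  have hdet : (g' : Matrix (Fin 2) (Fin 2) F).det ≠ 0 := g'.det_ne_zero
  have ha : (g' : Matrix (Fin 2) (Fin 2) F) 0 0 ≠ 0 := fun h => hdet <| by
    rw [Matrix.det_fin_two, h, ← e00]; ring
  refine ⟨Units.mk0 _ ha, g' 0 1 / g' 0 0, isConj_iff.mpr ⟨P⁻¹, ?_⟩⟩
  rw [inv_inv, ← hg']
  ext i j
  fin_cases i <;> fin_cases j
  · simp [coe_jordan]
  · simp [coe_jordan, mul_div_cancel₀ _ ha]
  · simp [coe_jordan, ← e00]
  · simp [coe_jordan, ← e01]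

theorem exists_isConj_jordan_of_orderOf [Finite F] {p d : ℕ} [Fact p.Prime] [CharP F p]
    (hpd : ¬ p ∣ Nat.card F - 1) (hd : d ≠ 0) {g : GL (Fin 2) F} (hg : orderOf g = p * d) :
    ∃ (a : Fˣ) (b : F), orderOf a = d ∧ b ≠ 0 ∧ IsConj g (jordan (a, Multiplicative.ofAdd b)) := by
  have hp : p.Prime := Fact.out
  have hcoe : ∀ k, (g : Matrix (Fin 2) (Fin 2) F) ^ k = 1 ↔ p * d ∣ k := fun k => by
    rw [← hg, orderOf_dvd_iff_pow_eq_one, ← Units.val_pow_eq_pow_val, Units.val_eq_one]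
  set N : Matrix (Fin 2) (Fin 2) F := (g : Matrix (Fin 2) (Fin 2) F) ^ d - 1 with hN
  have hNp : N ^ p = 0 := by
    rw [hN, sub_pow_char_of_commute p (Commute.one_right _), one_pow, ← pow_mul,
      sub_eq_zero, hcoe, mul_comm]
  have hN0 : N ≠ 0 := by
    rw [hN, sub_ne_zero, Ne, hcoe]
    intro h
    have := Nat.le_of_dvd (Nat.pos_of_ne_zero hd) h
    nlinarith [hp.two_le, Nat.pos_of_ne_zero hd]
  obtain ⟨a, b, hab⟩ := exists_isConj_jordan ⟨p, hNp⟩ hN0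
    (((Commute.refl _).pow_right d).sub_right (Commute.one_right _))
  have hconj : orderOf (jordan (a, Multiplicative.ofAdd b)) = p * d := by
    obtain ⟨c, hc⟩ := isConj_iff.mp hab
    rw [← hc, ← hg, ← MulAut.conj_apply, MulEquiv.orderOf_eq]
  have hpa : ¬ p ∣ orderOf a := fun h => hpd <| by
    rw [← Nat.card_units]
    exact h.trans (orderOf_dvd_natCard a)
  have hb : b ≠ 0 := by
    rintro rfl
    rw [orderOf_jordan_zero] at hconj
    exact hpa (hconj ▸ dvd_mul_right p d)
  refine ⟨a, b, ?_, hb, hab⟩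
  rw [orderOf_jordan p a hb, Nat.Coprime.lcm_eq_mul ((hp.coprime_iff_not_dvd.mpr hpa).symm),
    mul_comm] at hconj
  exact Nat.eq_of_mul_eq_mul_left hp.pos hconj

end Jordan

section UpperBound

variable {F : Type} [Field F] [Fintype F] {V : Type*} [AddCommGroup V] [Module ℂ V]

/-- The average of the operators by which the upper unitriangular matrices act. -/
noncomputable def unipotentAverage (ρ : Representation ℂ (GL (Fin 2) F) V) : Module.End ℂ V :=
  (Fintype.card F : ℂ)⁻¹ • ∑ b : F, ρ (jordan (1, Multiplicative.ofAdd b))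

theorem isIdempotentElem_unipotentAverage (ρ : Representation ℂ (GL (Fin 2) F) V) :
    IsIdempotentElem (unipotentAverage ρ) := by
  have hF : (Fintype.card F : ℂ) ≠ 0 := Nat.cast_ne_zero.mpr Fintype.card_ne_zero
  have h : ∀ b : F, ρ (jordan (1, Multiplicative.ofAdd b)) * unipotentAverage ρ =
      unipotentAverage ρ := fun b => by
    rw [unipotentAverage, mul_smul_comm, Finset.mul_sum]
    congr 1
    refine Fintype.sum_equiv (Equiv.addLeft b) _ _ fun c => ?_
    rw [← map_mul, ← map_mul, Prod.mk_mul_mk, one_mul, ← ofAdd_add, Equiv.coe_addLeft]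
  rw [IsIdempotentElem]
  nth_rw 1 [unipotentAverage]
  rw [smul_mul_assoc, Finset.sum_mul, Finset.sum_congr rfl fun b _ => h b, Finset.sum_const,
    Finset.card_univ, ← Nat.cast_smul_eq_nsmul ℂ, smul_smul, inv_mul_cancel₀ hF, one_smul]

theorem jordan_mul_unipotentAverage (ρ : Representation ℂ (GL (Fin 2) F) V) (a : Fˣ) :
    ρ (jordan (a, Multiplicative.ofAdd 0)) * unipotentAverage ρ =
      (Fintype.card F : ℂ)⁻¹ • ∑ b : F, ρ (jordan (a, Multiplicative.ofAdd b)) := by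
  rw [unipotentAverage, mul_smul_comm, Finset.mul_sum]
  congr 1
  refine Finset.sum_congr rfl fun b _ => ?_
  rw [← map_mul, ← map_mul, Prod.mk_mul_mk, mul_one, ← ofAdd_add, zero_add]

theorem commute_unipotentAverage (ρ : Representation ℂ (GL (Fin 2) F) V) (a : Fˣ) :
    Commute (ρ (jordan (a, Multiplicative.ofAdd 0))) (unipotentAverage ρ) :=
  (Commute.sum_right _ _ _ fun b _ => by
    rw [Commute, SemiconjBy, ← map_mul, ← map_mul, ← map_mul, ← map_mul, mul_comm]).smul_right _

theorem character_jordan_mem [FiniteDimensional ℂ V] (ρ : Representation ℂ (GL (Fin 2) F) V)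
    (hF : 2 < Fintype.card F) {d : ℕ} (hd : d ≠ 0) {a : Fˣ} (ha : orderOf a = d) {b : F}
    (hb : b ≠ 0) : ρ.character (jordan (a, Multiplicative.ofAdd b)) ∈
      IntermediateField.adjoin ℚ {zeta d} := by
  classical
  have ha1 : a ^ d = 1 := ha ▸ pow_orderOf_eq_one a
  have hz : ρ (jordan (a, Multiplicative.ofAdd 0)) ^ (d + 1) =
      ρ (jordan (a, Multiplicative.ofAdd 0)) := by
    rw [← map_pow, ← map_pow, Prod.pow_mk, pow_succ, ha1, one_mul, ofAdd_zero, one_pow]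
  have hT := trace_mem_adjoin_zeta hd
    (ρ (jordan (a, Multiplicative.ofAdd 0)) * unipotentAverage ρ) (by
      rw [(commute_unipotentAverage ρ a).mul_pow, hz,
        (isIdempotentElem_unipotentAverage ρ).pow_succ_eq])
  have h0 := trace_mem_adjoin_zeta hd _ hz
  have hconst : ∀ c ∈ Finset.univ.erase (0 : F),
      LinearMap.trace ℂ V (ρ (jordan (a, Multiplicative.ofAdd c))) =
        ρ.character (jordan (a, Multiplicative.ofAdd b)) := fun c hc => by
    have hc0 : c ≠ 0 := Finset.ne_of_mem_erase hc
    obtain ⟨g, hg⟩ := isConj_iff.mp (isConj_jordan a b (div_ne_zero hc0 hb))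
    rw [div_mul_cancel₀ _ hb] at hg
    rw [← hg]
    exact ρ.char_conj _ g
  rw [jordan_mul_unipotentAverage, map_smul, map_sum,
    ← Finset.add_sum_erase _ _ (Finset.mem_univ (0 : F)), Finset.sum_congr rfl hconst,
    Finset.sum_const, Finset.card_erase_of_mem (Finset.mem_univ _), Finset.card_univ,
    smul_eq_mul, nsmul_eq_mul] at hT
  have hF0 : (Fintype.card F : ℂ) ≠ 0 := Nat.cast_ne_zero.mpr (by omega)
  have hF1 : ((Fintype.card F - 1 : ℕ) : ℂ) ≠ 0 := Nat.cast_ne_zero.mpr (by omega)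
  have key := mul_mem (inv_mem (natCast_mem (IntermediateField.adjoin ℚ {zeta d})
    (Fintype.card F - 1))) (sub_mem (mul_mem (natCast_mem _ (Fintype.card F)) hT) h0)
  rwa [mul_inv_cancel_left₀ hF0, add_sub_cancel_left, inv_mul_cancel_left₀ hF1] at key

end UpperBound

theorem trace_eq_sum_single {X : Type*} [Fintype X] [DecidableEq X] (L : Module.End ℂ (X → ℂ)) :
    LinearMap.trace ℂ _ L = ∑ x, L (Pi.single x 1) x := by
  rw [LinearMap.trace_eq_matrix_trace ℂ (Pi.basisFun ℂ X)]
  simp [Matrix.trace]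

section LowerBound

variable {F : Type} [Field F]

/-- The functions on the plane that are homogeneous of degree `α`. -/
def homogeneousFunctions (α : Fˣ →* ℂˣ) : Submodule ℂ ((Fin 2 → F) → ℂ) where
  carrier := {f | ∀ (c : Fˣ) v, f (c • v) = α c * f v}
  add_mem' hf hg c v := by rw [Pi.add_apply, hf, hg, Pi.add_apply, mul_add]
  zero_mem' c v := by simp
  smul_mem' r f hf c v := by rw [Pi.smul_apply, hf, Pi.smul_apply, smul_eq_mul, smul_eq_mul,
    mul_left_comm]

/-- The action of `GL₂` by right translation on the functions on the plane. -/
def planeRep (F : Type) [Field F] : Representation ℂ (GL (Fin 2) F) ((Fin 2 → F) → ℂ) where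
  toFun g := LinearMap.funLeft ℂ ℂ fun v => Matrix.vecMul v (g : Matrix (Fin 2) (Fin 2) F)
  map_one' := by ext; simp [LinearMap.funLeft]
  map_mul' g h := by ext; simp [LinearMap.funLeft]

theorem planeRep_apply (g : GL (Fin 2) F) (f : (Fin 2 → F) → ℂ) (v : Fin 2 → F) :
    planeRep F g f v = f (Matrix.vecMul v (g : Matrix (Fin 2) (Fin 2) F)) := rfl

/-- The homogeneous functions of degree `α` as a subrepresentation: the representation of `GL₂`
induced from a character of the subgroup of matrices that stabilise a line. -/
def homogeneousRep (α : Fˣ →* ℂˣ) : Subrepresentation (planeRep F) where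
  toSubmodule := homogeneousFunctions α
  apply_mem_toSubmodule g f hf c v := by
    rw [planeRep_apply, planeRep_apply, Matrix.smul_vecMul, hf]

theorem smul_vecMul_jordan_eq_self_iff {a c : Fˣ} {b : F} {v : Fin 2 → F} (hv : v ≠ 0) :
    c • Matrix.vecMul v (jordan (a, Multiplicative.ofAdd b) : Matrix (Fin 2) (Fin 2) F) = v ↔
      c = a⁻¹ ∧ v 0 * b = 0 := by
  rw [eq_inv_iff_mul_eq_one, ← Units.val_eq_one, Units.val_mul]
  have h0 : ∀ w : Fin 2 → F, c • w = v ↔ (c : F) * w 0 = v 0 ∧ (c : F) * w 1 = v 1 := fun w => by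
    rw [funext_iff, Fin.forall_fin_two]; rfl
  rw [h0]
  simp only [coe_jordan, toAdd_ofAdd, Matrix.vecMul, dotProduct, Fin.sum_univ_two, Matrix.of_apply,
    Matrix.cons_val', Matrix.cons_val_zero, Matrix.cons_val_one, Matrix.cons_val_fin_one,
    mul_zero, add_zero]
  constructor
  · rintro ⟨h1, h2⟩
    have hca : (c : F) * a = 1 := by
      by_cases hx : v 0 = 0
      · have hy : v 1 ≠ 0 := fun hy => hv (by ext i; fin_cases i <;> simpa)
        rw [hx, zero_mul, zero_add] at h2
        exact mul_right_cancel₀ hy (by linear_combination h2)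
      · exact mul_right_cancel₀ hx (by linear_combination h1)
    exact ⟨hca, by linear_combination h2 - (v 0 * b + v 1) * hca⟩
  · rintro ⟨hca, hb⟩
    exact ⟨by linear_combination v 0 * hca, by linear_combination v 1 * hca + (c : F) * a * hb⟩

variable [Fintype F] [DecidableEq F]

/-- The projection onto the homogeneous functions of degree `α`. -/
noncomputable def homogeneousProj (α : Fˣ →* ℂˣ) : Module.End ℂ ((Fin 2 → F) → ℂ) :=
  (Fintype.card Fˣ : ℂ)⁻¹ • ∑ c : Fˣ, (↑(α c)⁻¹ : ℂ) • LinearMap.funLeft ℂ ℂ fun v => c • v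

theorem homogeneousProj_apply (α : Fˣ →* ℂˣ) (f : (Fin 2 → F) → ℂ) (v : Fin 2 → F) :
    homogeneousProj α f v =
      (Fintype.card Fˣ : ℂ)⁻¹ * ∑ c : Fˣ, (↑(α c)⁻¹ : ℂ) * f (c • v) := by
  simp [homogeneousProj, LinearMap.sum_apply, Finset.sum_apply, LinearMap.funLeft_apply]

theorem homogeneousProj_mem (α : Fˣ →* ℂˣ) (f : (Fin 2 → F) → ℂ) :
    homogeneousProj α f ∈ homogeneousFunctions α := by
  intro c v
  rw [homogeneousProj_apply, homogeneousProj_apply, mul_left_comm]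
  congr 1
  rw [Finset.mul_sum]
  refine Fintype.sum_equiv (Equiv.mulRight c) _ _ fun x => ?_
  rw [Equiv.coe_mulRight, map_mul, mul_inv, Units.val_mul, mul_smul, ← mul_assoc,
    mul_comm (α c : ℂ), mul_assoc (↑(α x)⁻¹ : ℂ), Units.inv_mul, mul_one]

theorem homogeneousProj_of_mem (α : Fˣ →* ℂˣ) {f : (Fin 2 → F) → ℂ}
    (hf : f ∈ homogeneousFunctions α) : homogeneousProj α f = f := by
  ext v
  have hF : (Fintype.card Fˣ : ℂ) ≠ 0 := Nat.cast_ne_zero.mpr Fintype.card_ne_zero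
  rw [homogeneousProj_apply]
  simp_rw [hf _ v, Units.inv_mul_cancel_left]
  rw [Finset.sum_const, Finset.card_univ, nsmul_eq_mul, inv_mul_cancel_left₀ hF]

theorem character_homogeneousRep (α : Fˣ →* ℂˣ) (g : GL (Fin 2) F) :
    (homogeneousRep α).toRepresentation.character g =
      LinearMap.trace ℂ ((Fin 2 → F) → ℂ) (planeRep F g * homogeneousProj α) := by
  have h : ∀ f : (Fin 2 → F) → ℂ,
      (planeRep F g * homogeneousProj α) f ∈ homogeneousFunctions α := fun f =>
    (homogeneousRep α).apply_mem_toSubmodule g (homogeneousProj_mem α f)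
  rw [← LinearMap.trace_restrict_eq_of_forall_mem _ _ h]
  refine congrArg (LinearMap.trace ℂ (homogeneousFunctions α))
    (LinearMap.ext fun f => Subtype.ext ?_)
  change planeRep F g (f : (Fin 2 → F) → ℂ) = planeRep F g (homogeneousProj α f)
  rw [homogeneousProj_of_mem α f.2]

theorem character_homogeneousRep_jordan {α : Fˣ →* ℂˣ} (hα : α ≠ 1) (a : Fˣ) (b : F) :
    (homogeneousRep α).toRepresentation.character (jordan (a, Multiplicative.ofAdd b)) =
      (Fintype.card Fˣ : ℂ)⁻¹ *
        ((Finset.univ.filter fun v : Fin 2 → F => v ≠ 0 ∧ v 0 * b = 0).card * α a) := by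
  rw [character_homogeneousRep, trace_eq_sum_single]
  simp_rw [Module.End.mul_apply, planeRep_apply, homogeneousProj_apply]
  rw [← Finset.mul_sum, ← nsmul_eq_mul, ← Finset.sum_const, Finset.sum_filter]
  congr 1
  refine Finset.sum_congr rfl fun v _ => ?_
  rcases eq_or_ne v 0 with rfl | hv
  · have h := sum_hom_units_eq_zero ((Units.coeHom ℂ).comp α⁻¹) fun h => hα <| by
      ext c
      simpa using DFunLike.congr_fun h c
    simpa using h
  · simp only [Pi.single_apply, smul_vecMul_jordan_eq_self_iff hv, mul_ite, mul_one, mul_zero]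
    by_cases hb : v 0 * b = 0
    · simp [hv, hb]
    · simp [hb]

theorem apply_mem_charFieldAt {α : Fˣ →* ℂˣ} (hα : α ≠ 1) (a : Fˣ) (b : F) :
    (α a : ℂ) ∈ charFieldAt (GL (Fin 2) F) (orderOf (jordan (a, Multiplicative.ofAdd b))) := by
  have h := character_mem_charFieldAt (homogeneousRep α).toRepresentation
    (jordan (a, Multiplicative.ofAdd b))
  rw [character_homogeneousRep_jordan hα] at h
  set S := Finset.univ.filter fun v : Fin 2 → F => v ≠ 0 ∧ v 0 * b = 0
  have hS : (S.card : ℂ) ≠ 0 := by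
    refine Nat.cast_ne_zero.mpr (Finset.card_ne_zero_of_mem (a := ![0, 1]) ?_)
    simp [S]
  have hF : (Fintype.card Fˣ : ℂ) ≠ 0 := Nat.cast_ne_zero.mpr Fintype.card_ne_zero
  have key := mul_mem (inv_mem (natCast_mem _ S.card)) (mul_mem (natCast_mem _ (Fintype.card Fˣ)) h)
  rwa [mul_inv_cancel_left₀ hF, inv_mul_cancel_left₀ hS] at key

end LowerBound

theorem exists_character_apply_eq_zeta {F : Type} [Field F] [Fintype F] {d : ℕ}
    (hd : d ∣ Fintype.card F - 1) :
    ∃ (α : Fˣ →* ℂˣ) (a : Fˣ), orderOf a = d ∧ (α a : ℂ) = zeta d := by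
  classical
  obtain ⟨γ, hγ⟩ := IsCyclic.exists_generator (α := Fˣ)
  have hord : orderOf γ = Fintype.card F - 1 := by
    rw [orderOf_eq_card_of_forall_mem_zpowers hγ, Nat.card_units, Nat.card_eq_fintype_card]
  have h0 : Fintype.card F - 1 ≠ 0 := by
    have := Fintype.one_lt_card (α := F)
    omega
  set m := Fintype.card F - 1
  have hz := Complex.isPrimitiveRoot_exp m h0
  obtain ⟨k, hk⟩ := hd
  have hd0 : d ≠ 0 := by rintro rfl; simp [hk] at h0
  have hk0 : k ≠ 0 := by rintro rfl; simp [hk] at h0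
  let u : ℂˣ := Units.mk0 _ (hz.ne_zero h0)
  have hu : orderOf u ∣ orderOf γ := by
    rw [hord, orderOf_dvd_iff_pow_eq_one]
    exact Units.ext hz.pow_eq_one
  refine ⟨monoidHomOfForallMemZpowers hγ hu, γ ^ k, ?_, ?_⟩
  · rw [orderOf_pow_of_dvd hk0 (by rw [hord, hk]; exact dvd_mul_left k d), hord, hk,
      Nat.mul_div_cancel _ (Nat.pos_of_ne_zero hk0)]
  · rw [map_pow, monoidHomOfForallMemZpowers_apply_gen, Units.val_pow_eq_pow_val]
    change Complex.exp _ ^ k = _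
    rw [← Complex.exp_nat_mul, zeta, hk]
    congr 1
    push_cast
    field_simp

/-- For `d ∣ q − 1` with `d > 1`,
`K_d(GL_2(F_q)) = K_{pd}(GL_2(F_q)) = ℚ(ζ_d)`. -/
theorem statement10 (p n q d : ℕ) (hp : p.Prime) (hn : 1 ≤ n) (hq : q = p ^ n)
    (hd : d ∣ q - 1) (hd1 : 1 < d)
    (F : Type) [Field F] [Fintype F] (hF : Fintype.card F = q) :
    charFieldAt (GL (Fin 2) F) d = IntermediateField.adjoin ℚ {zeta d} ∧
      charFieldAt (GL (Fin 2) F) (p * d) = IntermediateField.adjoin ℚ {zeta d} := by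
  classical
  have : Fact p.Prime := ⟨hp⟩
  have : CharP F p := charP_of_card_eq_prime_pow (hF.trans hq)
  have hq1 : 1 < q := hF ▸ Fintype.one_lt_card
  have hq2 : 2 < Fintype.card F := by
    have := Nat.le_of_dvd (by omega) hd
    omega
  have hpq : ¬ p ∣ q - 1 := fun h => by
    have h1 : p ∣ q := hq ▸ dvd_pow_self p (by omega)
    have h2 := (Nat.dvd_sub_iff_right hq1.le h1).mp h
    exact hp.one_lt.ne' (Nat.dvd_one.mp h2)
  have hpd : ¬ p ∣ d := fun h => hpq (h.trans hd)
  obtain ⟨α, a, ha, hαa⟩ := exists_character_apply_eq_zeta (F := F) (hF ▸ hd)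
  have hα : α ≠ 1 := by
    rintro rfl
    exact (Complex.isPrimitiveRoot_exp d (by omega)).ne_one hd1 (by simpa using! hαa.symm)
  refine ⟨le_antisymm ?_ ?_, le_antisymm ?_ ?_⟩
  · refine IntermediateField.adjoin_le_iff.mpr ?_
    rintro _ ⟨V, -, g, hg, rfl⟩
    refine trace_mem_adjoin_zeta (by omega) _ ?_
    rw [pow_succ, ← map_pow, ← hg, pow_orderOf_eq_one, map_one, one_mul]
  · rw [IntermediateField.adjoin_simple_le_iff]
    have h := apply_mem_charFieldAt hα a 0
    rwa [orderOf_jordan_zero, ha, hαa] at h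
  · refine IntermediateField.adjoin_le_iff.mpr ?_
    rintro _ ⟨V, -, g, hg, rfl⟩
    obtain ⟨a, b, ha, hb, hab⟩ := exists_isConj_jordan_of_orderOf
      (by rwa [Nat.card_eq_fintype_card, hF]) (by omega) hg
    obtain ⟨c, hc⟩ := isConj_iff.mp hab
    have h := character_jordan_mem V.ρ hq2 (by omega) ha hb
    rw [← hc, Representation.char_conj] at h
    exact h
  · rw [IntermediateField.adjoin_simple_le_iff]
    have h := apply_mem_charFieldAt hα a 1
    rwa [orderOf_jordan p a one_ne_zero, ha,
      Nat.Coprime.lcm_eq_mul ((hp.coprime_iff_not_dvd.mpr hpd).symm), mul_comm, hαa] at h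
end
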